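/- arXiv:2307.13318 — 5 statements merged into one kernel-verified Lean document; each statement's English description precedes it below -/
import Mathlib

section
/- Let A be an m×n real matrix, b ∈ ℝ^m, c ∈ ℝ^n and d ∈ ℝ. Suppose the affine assertion φ is satisfiable, i.e., there exists x ∈ ℝ^n with (A.mulVec x) i + b i ≥ 0 for all i. Then φ implies the affine inequality ψ — that is, for every x ∈ ℝ^n, (∀ i, (A.mulVec x) i + b i ≥ 0) → (⟨c, x⟩ + d ≥ 0) — if and only if there exist a real number λ₀ ≥ 0 and a vector λ ∈ ℝ^m with λ i ≥ 0 for all i, such that c j = ∑ i, λ i * A i j for every j, and d = λ₀ + ∑ i, λ i * b i. -/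
/-- **Farkas' lemma** for finitely many linear functionals on a vector space over an ordered
field. -/
theorem exists_nonneg_combination_of_nonneg {K V : Type*} [Field K] [LinearOrder K]
    [IsStrictOrderedRing K] [AddCommGroup V] [Module K V] {m : ℕ} (f : Fin m → Module.Dual K V)
    (g : Module.Dual K V) (h : ∀ x, (∀ i, 0 ≤ f i x) → 0 ≤ g x) :
    ∃ l : Fin m → K, (∀ i, 0 ≤ l i) ∧ g = ∑ i, l i • f i := by
  induction m generalizing g with
  | zero =>
    refine ⟨0, fun _ => le_rfl, LinearMap.ext fun x => ?_⟩
    have hneg := h (-x) (fun i => i.elim0)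
    rw [map_neg] at hneg
    simpa using le_antisymm (by linarith) (h x fun i => i.elim0)
  | succ m ih =>
    by_cases hg : ∀ x, (∀ i : Fin m, 0 ≤ f i.succ x) → 0 ≤ g x
    · obtain ⟨l, hl, hgl⟩ := ih (fun i => f i.succ) g hg
      exact ⟨Fin.cons 0 l, Fin.cases le_rfl hl, by simpa [Fin.sum_univ_succ] using hgl⟩
    · push Not at hg
      obtain ⟨y, hy, hgy⟩ := hg
      have hfy : f 0 y < 0 := by
        by_contra! h0
        exact hgy.not_ge (h y (Fin.cases h0 hy))
      -- Project onto the kernel of `f 0` along `z`, where `f 0 z = -1`.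
      set z := (-(f 0 y))⁻¹ • y
      have hpos : 0 < (-(f 0 y))⁻¹ := inv_pos.2 (neg_pos.2 hfy)
      have hz : ∀ i : Fin m, 0 ≤ f i.succ z := fun i => by
        simpa only [z, map_smul, smul_eq_mul] using mul_nonneg hpos.le (hy i)
      have hgz : g z ≤ 0 := by
        simpa only [z, map_smul, smul_eq_mul] using mul_nonpos_of_nonneg_of_nonpos hpos.le hgy.le
      have hfz : f 0 z = -1 := by
        simp only [z, map_smul, smul_eq_mul]
        field_simp [hfy.ne]
      obtain ⟨l, hl, hgl⟩ := ih (fun i => f i.succ + f i.succ z • f 0) (g + g z • f 0)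
        (fun x hx => by
          have hproj := h (x + f 0 x • z) (Fin.cases (by simp [hfz]) fun i => by
            simpa [mul_comm] using hx i)
          simpa [mul_comm] using hproj)
      have hcoeff : 0 ≤ ∑ i, l i * f i.succ z - g z :=
        sub_nonneg.2 (hgz.trans (Finset.sum_nonneg fun i _ => mul_nonneg (hl i) (hz i)))
      refine ⟨Fin.cons (∑ i, l i * f i.succ z - g z) l, Fin.cases hcoeff hl, ?_⟩
      ext x
      have hx := LinearMap.congr_fun hgl x
      simp only [LinearMap.add_apply, LinearMap.sum_apply, LinearMap.smul_apply, smul_eq_mul,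
        mul_add, Finset.sum_add_distrib, ← mul_assoc, ← Finset.sum_mul] at hx
      rw [LinearMap.sum_apply, Fin.sum_univ_succ]
      simp only [LinearMap.smul_apply, smul_eq_mul, Fin.cons_zero, Fin.cons_succ]
      linear_combination hx

/-- If `x ↦ a + s * x` is bounded below by `0` for all `s ≥ 0`, its slope is nonnegative. -/
theorem nonneg_of_forall_nonneg_add_mul {K : Type*} [Field K] [LinearOrder K]
    [IsStrictOrderedRing K] {a x : K} (h : ∀ s, 0 ≤ s → 0 ≤ a + s * x) : 0 ≤ x := by
  by_contra! hx
  have ha : 0 ≤ a := by simpa using h 0 le_rfl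
  have hs := h ((a + 1) / -x) (div_nonneg (by linarith) (by linarith))
  have hmul : (a + 1) / -x * x = -(a + 1) := by
    field_simp [hx.ne]
  linarith


/-- **Farkas' Lemma (satisfiable case).**
If the affine assertion `φ : ∀ i, (A.mulVec x) i + b i ≥ 0` is satisfiable, then `φ`
implies the affine inequality `⟨c, x⟩ + d ≥ 0` for every `x` iff there exist a
nonnegative real `λ₀` and a nonnegative vector `λ` of multipliers such that
`c j = ∑ i, λ i * A i j` for every `j` and `d = λ₀ + ∑ i, λ i * b i`. -/
theorem farkas_lemma_satisfiable_case
    {m n : ℕ} (A : Matrix (Fin m) (Fin n) ℝ) (b : Fin m → ℝ) (c : Fin n → ℝ) (d : ℝ)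
    (hsat : ∃ x : Fin n → ℝ, ∀ i, A.mulVec x i + b i ≥ 0) :
    (∀ x : Fin n → ℝ, (∀ i, A.mulVec x i + b i ≥ 0) → (∑ j, c j * x j) + d ≥ 0) ↔
      ∃ (l0 : ℝ) (l : Fin m → ℝ), l0 ≥ 0 ∧ (∀ i, l i ≥ 0) ∧
        (∀ j, c j = ∑ i, l i * A i j) ∧ d = l0 + ∑ i, l i * b i := by
  constructor
  · intro h
    obtain ⟨x₀, hx₀⟩ := hsat
    let p : Module.Dual ℝ ((Fin n → ℝ) × ℝ) := LinearMap.snd ℝ _ _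
    let f : Fin m → Module.Dual ℝ ((Fin n → ℝ) × ℝ) := fun i =>
      (LinearMap.proj i ∘ₗ A.mulVecLin).coprod (b i • LinearMap.id)
    let g : Module.Dual ℝ ((Fin n → ℝ) × ℝ) :=
      (dotProductBilin ℝ ℝ c).coprod (d • LinearMap.id)
    have hf : ∀ i x t, f i (x, t) = A.mulVec x i + b i * t := fun i x t => by simp [f]
    have hg : ∀ x t, g (x, t) = c ⬝ᵥ x + d * t := fun x t => by simp [g]
    have hp : ∀ x t, p (x, t) = t := fun _ _ => rfl
    obtain ⟨l, hl, hgl⟩ := exists_nonneg_combination_of_nonneg (Fin.cons p f) g (by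
      rintro ⟨x, t⟩ hx
      have ht : 0 ≤ t := hx 0
      have hfx : ∀ i, 0 ≤ A.mulVec x i + b i * t := fun i => hf i x t ▸ hx i.succ
      rw [hg]
      rcases ht.eq_or_lt with rfl | ht
      · simp only [mul_zero, add_zero] at hfx ⊢
        refine nonneg_of_forall_nonneg_add_mul (a := c ⬝ᵥ x₀ + d) fun s hs => ?_
        have hray := h (x₀ + s • x) fun i => by
          have := mul_nonneg hs (hfx i)
          have := hx₀ i
          simp only [Matrix.mulVec_add, Matrix.mulVec_smul, Pi.add_apply, Pi.smul_apply,
            smul_eq_mul]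
          linarith
        change c ⬝ᵥ (x₀ + s • x) + d ≥ 0 at hray
        rw [dotProduct_add, dotProduct_smul, smul_eq_mul] at hray
        linarith
      · have hscaled := h (t⁻¹ • x) fun i => by
          have := mul_nonneg (inv_nonneg.2 ht.le) (hfx i)
          rw [Matrix.mulVec_smul, Pi.smul_apply, smul_eq_mul]
          rwa [mul_add, mul_left_comm, inv_mul_cancel₀ ht.ne', mul_one] at this
        change c ⬝ᵥ (t⁻¹ • x) + d ≥ 0 at hscaled
        rw [dotProduct_smul, smul_eq_mul] at hscaled
        have := mul_nonneg ht.le hscaled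
        rwa [mul_add, mul_inv_cancel_left₀ ht.ne', mul_comm t d] at this)
    have hgl' : ∀ x t, c ⬝ᵥ x + d * t =
        l 0 * t + ∑ i : Fin m, l i.succ * (A.mulVec x i + b i * t) :=
      fun x t => by
        rw [← hg, hgl]
        simp [Fin.sum_univ_succ, hf, hp]
    refine ⟨l 0, fun i => l i.succ, hl 0, fun i => hl i.succ, fun j => ?_, ?_⟩
    · simpa using hgl' (Pi.single j 1) 0
    · simpa using hgl' 0 1
  · rintro ⟨l0, l, hl0, hl, hc, rfl⟩ x hx
    have hcx : ∑ j, c j * x j = ∑ i, l i * A.mulVec x i := by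
      obtain rfl : c = Matrix.vecMul l A := funext hc
      exact (Matrix.dotProduct_mulVec l A x).symm
    have hnonneg : 0 ≤ ∑ i, l i * (A.mulVec x i + b i) :=
      Finset.sum_nonneg fun i _ => mul_nonneg (hl i) (hx i)
    simp only [mul_add, Finset.sum_add_distrib] at hnonneg
    linarith
end

section
/- Let A be an m×n real matrix, b ∈ ℝ^m, c ∈ ℝ^n, d ∈ ℝ, and let E ⊆ {1,…,m} be a set of row indices designated as equalities. Suppose the mixed system φ is satisfiable, i.e., there exists x ∈ ℝ^n with (A.mulVec x) i + b i = 0 for all i ∈ E and (A.mulVec x) i + b i ≥ 0 for all i ∉ E. Then φ implies ⟨c, x⟩ + d ≥ 0 for all x ∈ ℝ^n if and only if there exist λ₀ ≥ 0 and λ ∈ ℝ^m with λ i ≥ 0 for all i ∉ E (and λ i unrestricted in sign for i ∈ E), such that c j = ∑ i, λ i * A i j for every j and d = λ₀ + ∑ i, λ i * b i. -/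
/-- **Farkas' lemma** for finitely many homogeneous linear constraints on a vector space over a
linearly ordered field, where the constraints indexed by `E` are equalities. -/
theorem exists_multipliers_of_forall_nonneg {𝕜 V ι : Type*} [Field 𝕜] [LinearOrder 𝕜]
    [IsStrictOrderedRing 𝕜] [AddCommGroup V] [Module 𝕜 V] (E : Set ι) (s : Finset ι)
    (f : ι → V →ₗ[𝕜] 𝕜) (g : V →ₗ[𝕜] 𝕜)
    (h : ∀ x, (∀ i ∈ s, i ∈ E → f i x = 0) → (∀ i ∈ s, i ∉ E → 0 ≤ f i x) → 0 ≤ g x) :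
    ∃ l : ι → 𝕜, (∀ i ∉ E, 0 ≤ l i) ∧ ∀ x, g x = ∑ i ∈ s, l i * f i x := by
  classical
  induction s using Finset.induction_on generalizing f g with
  | empty =>
    refine ⟨0, fun _ _ => le_rfl, fun x => ?_⟩
    have h₁ := h x (by simp) (by simp)
    have h₂ := h (-x) (by simp) (by simp)
    rw [map_neg] at h₂
    rw [Finset.sum_empty]
    linarith
  | insert a s ha ih =>
    by_cases hs : ∀ x, (∀ i ∈ s, i ∈ E → f i x = 0) → (∀ i ∈ s, i ∉ E → 0 ≤ f i x) → 0 ≤ g x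
    · obtain ⟨l, hl, hg⟩ := ih f g hs
      refine ⟨Function.update l a 0, fun i hi => ?_, fun x => ?_⟩
      · by_cases hia : i = a
        · simp [hia]
        · simpa [hia] using hl i hi
      · rw [Finset.sum_insert ha, hg x, Function.update_self, zero_mul, zero_add]
        refine Finset.sum_congr rfl fun i hi => ?_
        rw [Function.update_of_ne (ne_of_mem_of_not_mem hi ha)]
    push Not at hs
    obtain ⟨x₀, hx₀E, hx₀, hgx₀⟩ := hs
    have hne : f a x₀ ≠ 0 := fun h₀ => hgx₀.not_ge <| h x₀
      (by simpa [h₀] using hx₀E) (by simpa [h₀] using hx₀)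
    have hneg : a ∉ E → f a x₀ < 0 := fun haE => by
      by_contra! h₀
      exact hgx₀.not_ge <| h x₀ (by simpa [haE] using hx₀E)
        (by simpa [h₀] using hx₀)
    -- Project along `x₀` onto the kernel of `f a`.
    let P : V →ₗ[𝕜] V := LinearMap.id - ((f a x₀)⁻¹ • f a).smulRight x₀
    have hP (φ : V →ₗ[𝕜] 𝕜) (x : V) : φ (P x) = φ x - (f a x₀)⁻¹ * f a x * φ x₀ := by
      simp [P]
    have hPa (x : V) : f a (P x) = 0 := by
      rw [hP]
      field_simp
      ring
    obtain ⟨l, hl, hg⟩ := ih (fun i => f i ∘ₗ P) (g ∘ₗ P) fun x hE hN =>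
      h (P x) (by simpa [hPa] using hE) (by simpa [hPa] using hN)
    have hsum : 0 ≤ ∑ i ∈ s, l i * f i x₀ := Finset.sum_nonneg fun i hi => by
      by_cases hiE : i ∈ E
      · simp [hx₀E i hi hiE]
      · exact mul_nonneg (hl i hiE) (hx₀ i hi hiE)
    refine ⟨Function.update l a ((g x₀ - ∑ i ∈ s, l i * f i x₀) / f a x₀),
      fun i hi => ?_, fun x => ?_⟩
    · by_cases hia : i = a
      · subst hia
        rw [Function.update_self]
        exact div_nonneg_of_nonpos (by linarith) (hneg hi).le
      · simpa [hia] using hl i hi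
    · have hx := hg x
      simp only [LinearMap.comp_apply, hP, mul_sub, Finset.sum_sub_distrib] at hx
      have hfactor : ∑ i ∈ s, l i * ((f a x₀)⁻¹ * f a x * f i x₀) =
          (f a x₀)⁻¹ * f a x * ∑ i ∈ s, l i * f i x₀ := by
        rw [Finset.mul_sum]
        exact Finset.sum_congr rfl fun i _ => by ring
      have hrest : ∑ i ∈ s, Function.update l a
          ((g x₀ - ∑ i ∈ s, l i * f i x₀) / f a x₀) i * f i x = ∑ i ∈ s, l i * f i x :=
        Finset.sum_congr rfl fun i hi => by
          rw [Function.update_of_ne (ne_of_mem_of_not_mem hi ha)]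
      rw [Finset.sum_insert ha, Function.update_self, hrest, div_eq_mul_inv]
      rw [hfactor] at hx
      linear_combination hx


/-- **Farkas' Lemma with equality rows.**
Let `E` be the set of row indices designated as equalities. If the mixed system
`(∀ i ∈ E, (A.mulVec x) i + b i = 0) ∧ (∀ i ∉ E, (A.mulVec x) i + b i ≥ 0)` is
satisfiable, then it implies `⟨c, x⟩ + d ≥ 0` for all `x` iff there exist `λ₀ ≥ 0` and
multipliers `λ` that are nonnegative on rows outside `E` (and unrestricted in sign on
`E`), with `c j = ∑ i, λ i * A i j` for every `j` and `d = λ₀ + ∑ i, λ i * b i`. -/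
theorem farkas_lemma_with_equalities
    {m n : ℕ} (A : Matrix (Fin m) (Fin n) ℝ) (b : Fin m → ℝ) (c : Fin n → ℝ) (d : ℝ)
    (E : Set (Fin m))
    (hsat : ∃ x : Fin n → ℝ,
      (∀ i ∈ E, A.mulVec x i + b i = 0) ∧ (∀ i ∉ E, A.mulVec x i + b i ≥ 0)) :
    (∀ x : Fin n → ℝ,
        (∀ i ∈ E, A.mulVec x i + b i = 0) → (∀ i ∉ E, A.mulVec x i + b i ≥ 0) →
        (∑ j, c j * x j) + d ≥ 0) ↔
      ∃ (l0 : ℝ) (l : Fin m → ℝ), l0 ≥ 0 ∧ (∀ i ∉ E, l i ≥ 0) ∧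
        (∀ j, c j = ∑ i, l i * A i j) ∧ d = l0 + ∑ i, l i * b i := by
  constructor
  · intro h
    obtain ⟨z, hzE, hz⟩ := hsat
    let f : Option (Fin m) → ((Fin n → ℝ) × ℝ) →ₗ[ℝ] ℝ := fun o => o.elim (LinearMap.snd ℝ _ _)
      fun i => (LinearMap.proj i ∘ₗ A.mulVecLin).coprod (b i • LinearMap.id)
    let g : ((Fin n → ℝ) × ℝ) →ₗ[ℝ] ℝ :=
      (dotProductBilin ℝ ℝ c).coprod (d • LinearMap.id)
    have hf_none (p) : f none p = p.2 := rfl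
    have hf_some (i p) : f (some i) p = A.mulVec p.1 i + b i * p.2 := rfl
    have hg (p) : g p = ∑ j, c j * p.1 j + d * p.2 := rfl
    obtain ⟨l, hl, hgl⟩ := exists_multipliers_of_forall_nonneg (some '' E) Finset.univ f g (by
      rintro ⟨x, t⟩ hE hN
      have ht : 0 ≤ t := hN none (Finset.mem_univ _) (by simp)
      have hxE : ∀ i ∈ E, A.mulVec x i + b i * t = 0 := fun i hi =>
        hE (some i) (Finset.mem_univ _) (Set.mem_image_of_mem _ hi)
      have hx : ∀ i ∉ E, 0 ≤ A.mulVec x i + b i * t := fun i hi =>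
        hN (some i) (Finset.mem_univ _) (by simpa using hi)
      rw [hg]
      -- `z + r • (x, t)`, rescaled to last coordinate `1`, is feasible for every `r ≥ 0`.
      have key (r : ℝ) (hr : 0 ≤ r) :
          0 ≤ (∑ j, c j * z j + d) + r * (∑ j, c j * x j + d * t) := by
        have hpos : 0 < 1 + r * t := by positivity
        have hA (i) : A.mulVec ((1 + r * t)⁻¹ • (z + r • x)) i + b i =
            (1 + r * t)⁻¹ * ((A.mulVec z i + b i) + r * (A.mulVec x i + b i * t)) := by
          simp only [Matrix.mulVec_smul, Matrix.mulVec_add, Pi.smul_apply, Pi.add_apply,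
            smul_eq_mul]
          field_simp
          ring
        have hfeas := h ((1 + r * t)⁻¹ • (z + r • x))
          (fun i hi => by rw [hA, hzE i hi, hxE i hi]; simp)
          (fun i hi => by
            rw [hA]
            have := hz i hi
            have := hx i hi
            positivity)
        have hc : ∑ j, c j * ((1 + r * t)⁻¹ • (z + r • x)) j =
            (1 + r * t)⁻¹ * (∑ j, c j * z j + r * ∑ j, c j * x j) := by
          rw [Finset.mul_sum, ← Finset.sum_add_distrib, Finset.mul_sum]
          refine Finset.sum_congr rfl fun j _ => ?_
          simp only [Pi.smul_apply, Pi.add_apply, smul_eq_mul]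
          ring
        rw [hc] at hfeas
        have hmul := mul_nonneg hpos.le hfeas
        field_simp at hmul
        linarith
      by_contra! hlt
      have hz₀ := key 0 le_rfl
      have hr := key ((∑ j, c j * z j + d + 1) / -(∑ j, c j * x j + d * t))
        (div_nonneg (by linarith) (by linarith))
      rw [div_neg, neg_mul, div_mul_cancel₀ _ hlt.ne] at hr
      linarith)
    refine ⟨l none, fun i => l (some i), hl none (by simp),
      fun i hi => hl (some i) (by simpa using hi), fun j => ?_, ?_⟩
    · simpa [hg, hf_none, hf_some, Fintype.sum_option, Pi.single_apply] using
        hgl (Pi.single j 1, 0)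
    · simpa [hg, hf_none, hf_some, Fintype.sum_option] using hgl (0, 1)
  · rintro ⟨l0, l, hl0, hl, hc, hd⟩ x hxE hx
    have hsum : 0 ≤ ∑ i, l i * (A.mulVec x i + b i) := Finset.sum_nonneg fun i _ => by
      by_cases hi : i ∈ E
      · simp [hxE i hi]
      · exact mul_nonneg (hl i hi) (hx i hi)
    have hcx : ∑ j, c j * x j = ∑ i, l i * A.mulVec x i := by
      simp only [hc, Matrix.mulVec, dotProduct, Finset.sum_mul, Finset.mul_sum, mul_assoc]
      exact Finset.sum_comm
    simp only [mul_add, Finset.sum_add_distrib] at hsum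
    linarith
end

section
/- Let ℓ' be a location with ℓ' ≠ ℓ*. Suppose that, for every transition (ℓ, ℓ', ρ) ∈ T into ℓ' with ℓ ≠ ℓ', there is a predicate I_ℓ that is an invariant at ℓ and such that for all valuations σ, σ', I_ℓ(σ) and ρ(σ, σ') imply J(σ'). Suppose moreover that every self-loop transition (ℓ', ℓ', ρ) ∈ T preserves J, i.e., for all σ, σ', J(σ) and ρ(σ, σ') imply J(σ'). Then J is an invariant at ℓ'. -/
/-- The one-step relation of a transition system: `(ℓ, σ)` steps to `(ℓ', σ')` iff some
transition `(ℓ, ℓ', ρ)` in `T` satisfies `ρ σ σ'`. -/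
def Step {L S : Type*} (T : Set (L × L × (S → S → Prop))) (p q : L × S) : Prop :=
  ∃ ρ, (p.1, q.1, ρ) ∈ T ∧ ρ p.2 q.2

/-- A configuration is reachable if it is obtained from some initial configuration
`(ℓ*, σ₀)` with `θ σ₀` by the reflexive-transitive closure of the step relation. -/
def Reachable {L S : Type*} (T : Set (L × L × (S → S → Prop)))
    (ℓstar : L) (θ : S → Prop) (cfg : L × S) : Prop :=
  ∃ s₀, θ s₀ ∧ Relation.ReflTransGen (Step T) (ℓstar, s₀) cfg

/-- **Single-step soundness of invariant propagation.**
Let `ℓ' ≠ ℓ*`. If every incoming transition `(ℓ, ℓ', ρ) ∈ T` from `ℓ ≠ ℓ'` admits an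
invariant `I` at `ℓ` such that `I σ ∧ ρ σ σ'` implies `J σ'`, and every self-loop
transition `(ℓ', ℓ', ρ) ∈ T` preserves `J`, then `J` is an invariant at `ℓ'`. -/
theorem invariant_propagation_single_step
    {n : ℕ} {L : Type*}
    (T : Set (L × L × ((Fin n → ℝ) → (Fin n → ℝ) → Prop)))
    (ℓstar : L) (θ : (Fin n → ℝ) → Prop)
    (ℓ' : L) (J : (Fin n → ℝ) → Prop)
    (hne : ℓ' ≠ ℓstar)
    (hin : ∀ ℓ ρ, (ℓ, ℓ', ρ) ∈ T → ℓ ≠ ℓ' →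
      ∃ I : (Fin n → ℝ) → Prop,
        (∀ σ, Reachable T ℓstar θ (ℓ, σ) → I σ) ∧
        (∀ σ σ', I σ → ρ σ σ' → J σ'))
    (hself : ∀ ρ, (ℓ', ℓ', ρ) ∈ T → ∀ σ σ', J σ → ρ σ σ' → J σ') :
    ∀ σ, Reachable T ℓstar θ (ℓ', σ) → J σ := by
  rintro σ ⟨s₀, hs₀, hreach⟩
  suffices key : ∀ cfg, Relation.ReflTransGen (Step T) (ℓstar, s₀) cfg →
      cfg.1 = ℓ' → J cfg.2 from key _ hreach rfl
  intro cfg hcfg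
  induction hcfg with
  | refl => exact fun h => absurd h.symm hne
  | @tail p q hp hstep ih =>
    obtain ⟨ℓ, τ⟩ := p
    obtain ⟨ρ, hρ, hττ'⟩ := hstep
    intro hq
    rw [hq] at hρ
    by_cases hℓ : ℓ = ℓ'
    · subst hℓ
      exact hself ρ hρ _ _ (ih rfl) hττ'
    · obtain ⟨I, hI, hIJ⟩ := hin ℓ ρ hρ hℓ
      exact hIJ _ _ (hI τ ⟨s₀, hs₀, hp⟩) hττ'
end

section
/- Let V be a real vector space, let u, e, r_1, …, r_m ∈ V, and suppose there exist a real number k > 0 and nonnegative reals λ₀, λ_1, …, λ_m such that k • u + λ₀ • e + ∑ i, λ_i • r_i = -e. Then for every real K ≥ k there exist nonnegative reals μ₀, μ_1, …, μ_m such that K • u + μ₀ • e + ∑ i, μ_i • r_i = -e. -/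
/-- **Fixing the nonlinear multiplier loses no solutions.**
In a real vector space `V`, if `k • u + λ₀ • e + ∑ i, λ i • r i = -e` for some `k > 0`
and nonnegative multipliers `λ₀, λ₁, …, λ_m`, then for every `K ≥ k` there are
nonnegative multipliers `μ₀, μ₁, …, μ_m` with `K • u + μ₀ • e + ∑ i, μ i • r i = -e`. -/
theorem multiplier_rescaling
    {V : Type*} [AddCommGroup V] [Module ℝ V] {m : ℕ}
    (u e : V) (r : Fin m → V)
    (k : ℝ) (hk : k > 0) (l0 : ℝ) (l : Fin m → ℝ)
    (hl0 : l0 ≥ 0) (hl : ∀ i, l i ≥ 0)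
    (heq : k • u + l0 • e + ∑ i, l i • r i = -e) :
    ∀ K : ℝ, K ≥ k →
      ∃ (mu0 : ℝ) (mu : Fin m → ℝ), mu0 ≥ 0 ∧ (∀ i, mu i ≥ 0) ∧
        K • u + mu0 • e + ∑ i, mu i • r i = -e := by
  intro K hK
  have hc : 1 ≤ K / k := (one_le_div hk).2 hK
  have hc0 : 0 ≤ K / k := zero_le_one.trans hc
  refine ⟨K / k * l0 + (K / k - 1), fun i => K / k * l i,
    add_nonneg (mul_nonneg hc0 hl0) (sub_nonneg.2 hc), fun i => mul_nonneg hc0 (hl i), ?_⟩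
  have hscaled := congrArg (fun v => (K / k) • v) heq
  simp only [smul_add, smul_smul, Finset.smul_sum, div_mul_cancel₀ K hk.ne'] at hscaled
  linear_combination (norm := module) hscaled
end

section
/- Consider a transition system over valuations σ : Fin n → ℝ in which the initial condition is affine: θ(σ) ↔ ∀ i, (A₀.mulVec σ) i + (b₀) i ≥ 0 for a given m₀×n real matrix A₀ and b₀ ∈ ℝ^{m₀}; and every transition (ℓ, ℓ', ρ) ∈ T has an affine guard: ρ(σ, σ') ↔ ∀ i, ⟨a_i, σ⟩ + ⟨a'_i, σ'⟩ + b_i ≥ 0 for rows a_i, a'_i ∈ ℝ^n and b_i ∈ ℝ depending on the transition. Let c : L → ℝ^n and d : L → ℝ be template coefficients. Suppose: (Initialization witnesses) there exist λ₀ ≥ 0 and λ ∈ ℝ^{m₀} with all λ i ≥ 0 such that (c ℓ*) j = ∑ i, λ i * A₀ i j for all j and d ℓ* = λ₀ + ∑ i, λ i * (b₀) i; and (Consecution witnesses) for every transition (ℓ, ℓ', ρ) ∈ T with guard rows a_i, a'_i, b_i (i = 1,…,m) there exist μ ≥ 0, λ₀ ≥ 0 and λ_1,…,λ_m ≥ 0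 such that μ * (c ℓ) j + ∑ i, λ_i * (a_i) j = 0 for all j, ∑ i, λ_i * (a'_i) j = (c ℓ') j for all j, and μ * (d ℓ) + λ₀ + ∑ i, λ_i * b_i = d ℓ'. Then for every reachable configuration (ℓ, σ), ⟨c ℓ, σ⟩ + d ℓ ≥ 0. -/
theorem sum_mul_sum_mul_comm {ι κ R : Type*} [Fintype ι] [Fintype κ] [CommSemiring R]
    (l : ι → R) (a : ι → κ → R) (x : κ → R) :
    ∑ i, l i * ∑ j, a i j * x j = ∑ j, (∑ i, l i * a i j) * x j := by
  simp only [Finset.mul_sum, Finset.sum_mul, mul_assoc]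
  exact Finset.sum_comm

/-- A nonnegative combination of affine inequalities that hold at `x` holds at `x`. -/
theorem sum_mul_affine_nonneg {ι κ : Type*} [Fintype ι] [Fintype κ]
    (a : ι → κ → ℝ) (x : κ → ℝ) (b : ι → ℝ) {l : ι → ℝ} (hl : ∀ i, 0 ≤ l i)
    (h : ∀ i, 0 ≤ (∑ j, a i j * x j) + b i) :
    0 ≤ (∑ j, (∑ i, l i * a i j) * x j) + ∑ i, l i * b i := by
  rw [← sum_mul_sum_mul_comm, ← Finset.sum_add_distrib]
  exact Finset.sum_nonneg fun i _ => by
    rw [← mul_add]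
    exact mul_nonneg (hl i) (h i)

/-- **End-to-end soundness of constraint-based affine invariant generation via
Farkas' Lemma.** Suppose the initial condition is the affine assertion given by
`A₀, b₀`, every transition has an affine guard given by rows `aᵢ, a'ᵢ, bᵢ`, and the
template coefficients `c ℓ, d ℓ` admit Farkas multipliers witnessing the
initialization and consecution tabulars. Then `⟨c ℓ, σ⟩ + d ℓ ≥ 0` holds at every
reachable configuration `(ℓ, σ)`. -/
theorem farkas_invariant_generation_sound
    {n : ℕ} {L : Type*}
    (T : Set (L × L × ((Fin n → ℝ) → (Fin n → ℝ) → Prop)))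
    (ℓstar : L) (θ : (Fin n → ℝ) → Prop)
    {m₀ : ℕ} (A₀ : Matrix (Fin m₀) (Fin n) ℝ) (b₀ : Fin m₀ → ℝ)
    (hθ : ∀ σ, θ σ ↔ ∀ i, A₀.mulVec σ i + b₀ i ≥ 0)
    (c : L → Fin n → ℝ) (d : L → ℝ)
    (hinit : ∃ (l0 : ℝ) (l : Fin m₀ → ℝ), l0 ≥ 0 ∧ (∀ i, l i ≥ 0) ∧
      (∀ j, c ℓstar j = ∑ i, l i * A₀ i j) ∧ d ℓstar = l0 + ∑ i, l i * b₀ i)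
    (hcons : ∀ ℓ ℓ' ρ, (ℓ, ℓ', ρ) ∈ T →
      ∃ (m : ℕ) (a a' : Fin m → Fin n → ℝ) (bb : Fin m → ℝ),
        (∀ σ σ' : Fin n → ℝ, ρ σ σ' ↔
          ∀ i, (∑ j, a i j * σ j) + (∑ j, a' i j * σ' j) + bb i ≥ 0) ∧
        ∃ (μ l0 : ℝ) (l : Fin m → ℝ), μ ≥ 0 ∧ l0 ≥ 0 ∧ (∀ i, l i ≥ 0) ∧
          (∀ j, μ * c ℓ j + ∑ i, l i * a i j = 0) ∧
          (∀ j, ∑ i, l i * a' i j = c ℓ' j) ∧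
          μ * d ℓ + l0 + ∑ i, l i * bb i = d ℓ') :
    ∀ ℓ σ, Reachable T ℓstar θ (ℓ, σ) → (∑ j, c ℓ j * σ j) + d ℓ ≥ 0 := by
  rintro ℓ σ ⟨σ₀, hσ₀, hsteps⟩
  suffices H : ∀ p : L × (Fin n → ℝ), Relation.ReflTransGen (Step T) (ℓstar, σ₀) p →
      0 ≤ (∑ j, c p.1 j * p.2 j) + d p.1 from H _ hsteps
  intro p hp
  induction hp with
  | refl =>
    obtain ⟨l0, l, hl0, hl, hc, hd⟩ := hinit
    have hrows := sum_mul_affine_nonneg A₀ σ₀ b₀ hl ((hθ σ₀).1 hσ₀)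
    simp only [← hc] at hrows
    linarith
  | @tail p q _ hstep ih =>
    obtain ⟨ρ, hρT, hρ⟩ := hstep
    obtain ⟨m, a, a', bb, hguard, μ, l0, l, hμ, hl0, hl, hca, hca', hd⟩ := hcons _ _ _ hρT
    have hrows := sum_mul_affine_nonneg a p.2 (fun i => (∑ j, a' i j * q.2 j) + bb i) hl
      fun i => (hguard _ _).1 hρ i |>.trans_eq (add_assoc _ _ _)
    have hsource : ∑ j, (∑ i, l i * a i j) * p.2 j = -(μ * ∑ j, c p.1 j * p.2 j) := by
      rw [Finset.mul_sum, ← Finset.sum_neg_distrib]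
      exact Finset.sum_congr rfl fun j _ => by linear_combination p.2 j * hca j
    simp only [mul_add, Finset.sum_add_distrib, sum_mul_sum_mul_comm l a', hca', hsource]
      at hrows
    linarith [mul_nonneg hμ ih]
end
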